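/- For every complex α with Re(α) > 0, the fractional power 𝒞^α of the continuous Cesàro operator 𝒞 on L²(ℝ) (defined via the functional calculus for normal operators applied to the branch of z^α on the closed right half-plane with 1^α = 1 and 0^α := 0) equals the Hölder operator H_α. -/

import Mathlib

open MeasureTheory Complex Filter

noncomputable section

/-- `L²(ℝ)` with complex values. -/
abbrev L2 : Type := MeasureTheory.Lp ℂ 2 (MeasureTheory.volume : MeasureTheory.Measure ℝ)

/-- `C` is the continuous Cesàro operator on `L²(ℝ)`:
`(C f)(x) = ∫₀¹ f(ux) du`. -/
def IsCesaroOp (C : L2 →L[ℂ] L2) : Prop :=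
  ∀ f : L2, ∀ᵐ x : ℝ ∂MeasureTheory.volume, C f x = ∫ u in Set.Ioo (0:ℝ) 1, f (u * x)

/-- `T` is the Hausdorff operator with kernel `K`:
`(T f)(x) = ∫_ℝ K(u) f(ux) du`. -/
def IsHausdorffOp (K : ℝ → ℂ) (T : L2 →L[ℂ] L2) : Prop :=
  ∀ f : L2, ∀ᵐ x : ℝ ∂MeasureTheory.volume, T f x = ∫ u : ℝ, K u * f (u * x)

/-- The kernel `(1/Γ(α)) (log(1/u))^{α-1} χ_{(0,1)}(u)` of the Hölder operator `H_α`. -/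
def holderKernel (α : ℂ) : ℝ → ℂ := fun u =>
  if u ∈ Set.Ioo (0:ℝ) 1 then (Complex.Gamma α)⁻¹ * ((Real.log u⁻¹ : ℝ) : ℂ) ^ (α - 1) else 0

/-- weight `u^{-1/2}` -/
def wt (u : ℝ) : ENNReal := ENNReal.ofReal (u ^ (-(1/2) : ℝ))

/-- weight `u^{1/2}` -/
def wti (u : ℝ) : ENNReal := ENNReal.ofReal (u ^ ((1/2) : ℝ))

lemma measurable_wt : Measurable wt := by unfold wt; fun_prop
lemma measurable_wti : Measurable wti := by unfold wti; fun_prop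

lemma lintegral_scale (u : ℝ) (hu : 0 < u) (g : ℝ → ENNReal) (hg : Measurable g) :
    ∫⁻ x, g (u * x) = ENNReal.ofReal (u⁻¹) * ∫⁻ x, g x := by
  rw [← lintegral_map (f := g) hg (measurable_const_mul u), Real.map_volume_mul_left hu.ne',
    lintegral_smul_measure, abs_of_pos (inv_pos.2 hu), smul_eq_mul]

lemma lemA (L f : ℝ → ℂ) (hL : Measurable L) (hf : Measurable f) :
    ∫⁻ x, (∫⁻ u in Set.Ioo (0:ℝ) 1, ‖L u‖ₑ * ‖f (u * x)‖ₑ) ^ 2 ≤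
      (∫⁻ u in Set.Ioo (0:ℝ) 1, ‖L u‖ₑ * wt u) ^ 2 * ∫⁻ x, ‖f x‖ₑ ^ 2 := by
  have hw := measurable_wt
  have hwi := measurable_wti
  have key : ∀ x, (∫⁻ u in Set.Ioo (0:ℝ) 1, ‖L u‖ₑ * ‖f (u * x)‖ₑ) ^ 2 ≤
      (∫⁻ u in Set.Ioo (0:ℝ) 1, ‖L u‖ₑ * wt u) *
        ∫⁻ u in Set.Ioo (0:ℝ) 1, ‖L u‖ₑ * wti u * ‖f (u * x)‖ₑ ^ 2 := by
    intro x
    have hfm : Measurable fun u : ℝ => f (u * x) := by fun_prop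
    have h := ENNReal.lintegral_mul_le_Lp_mul_Lq (volume.restrict (Set.Ioo (0:ℝ) 1))
      Real.HolderConjugate.two_two
      (f := fun u => (‖L u‖ₑ * wt u) ^ (1/2 : ℝ))
      (g := fun u => (‖L u‖ₑ * wti u * ‖f (u * x)‖ₑ ^ 2) ^ (1/2 : ℝ))
      (by fun_prop) (by fun_prop)
    have hsq : ∀ a : ENNReal, (a ^ (1/2 : ℝ)) ^ (2 : ℝ) = a := by
      intro a; rw [← ENNReal.rpow_mul]; norm_num
    have hsq' : ∀ a : ENNReal, (a ^ (1/2 : ℝ)) ^ (2 : ℕ) = a := by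
      intro a; rw [← ENNReal.rpow_natCast, ← ENNReal.rpow_mul]; norm_num
    simp only [hsq] at h
    have e : ∀ u ∈ Set.Ioo (0:ℝ) 1, ‖L u‖ₑ * ‖f (u * x)‖ₑ =
        (‖L u‖ₑ * wt u) ^ (1/2 : ℝ) * (‖L u‖ₑ * wti u * ‖f (u * x)‖ₑ ^ 2) ^ (1/2 : ℝ) := by
      intro u hu
      rw [← ENNReal.mul_rpow_of_nonneg _ _ (by norm_num)]
      have h1 : wt u * wti u = 1 := by
        unfold wt wti
        rw [← ENNReal.ofReal_mul (by have := hu.1; positivity), ← Real.rpow_add hu.1]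
        norm_num
      have h2 : ‖L u‖ₑ * wt u * (‖L u‖ₑ * wti u * ‖f (u * x)‖ₑ ^ 2)
          = (‖L u‖ₑ * ‖f (u * x)‖ₑ) ^ 2 := by
        calc _ = (wt u * wti u) * (‖L u‖ₑ * ‖f (u * x)‖ₑ) ^ 2 := by ring
          _ = _ := by rw [h1, one_mul]
      rw [h2, ← ENNReal.rpow_natCast, ← ENNReal.rpow_mul]
      norm_num
    rw [setLIntegral_congr_fun measurableSet_Ioo e]
    refine (pow_le_pow_left' h 2).trans (le_of_eq ?_)
    rw [mul_pow, hsq', hsq']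
  refine (lintegral_mono key).trans ?_
  have hm2 : Measurable (Function.uncurry fun x u : ℝ => ‖L u‖ₑ * wti u * ‖f (u * x)‖ₑ ^ 2) := by
    unfold Function.uncurry
    fun_prop
  rw [lintegral_const_mul _ hm2.lintegral_prod_right, lintegral_lintegral_swap hm2.aemeasurable]
  have e2 : ∀ u ∈ Set.Ioo (0:ℝ) 1, ∫⁻ x, ‖L u‖ₑ * wti u * ‖f (u * x)‖ₑ ^ 2 =
      (‖L u‖ₑ * wt u) * ∫⁻ x, ‖f x‖ₑ ^ 2 := by
    intro u hu
    rw [lintegral_const_mul _ (by fun_prop), lintegral_scale u hu.1 (fun x => ‖f x‖ₑ ^ 2) (by fun_prop)]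
    have h1 : wti u * ENNReal.ofReal u⁻¹ = wt u := by
      unfold wt wti
      rw [← ENNReal.ofReal_mul (by have := hu.1; positivity), ← Real.rpow_neg_one,
        ← Real.rpow_add hu.1]
      norm_num
    rw [← h1]; ring
  rw [setLIntegral_congr_fun measurableSet_Ioo e2, lintegral_mul_const _ (by fun_prop), sq, mul_assoc]

lemma lintegral_wt_lt_top : ∫⁻ u in Set.Ioo (0:ℝ) 1, wt u < ⊤ := by
  have h : IntegrableOn (fun u : ℝ => u ^ (-(1/2) : ℝ)) (Set.Ioo 0 1) :=
    (intervalIntegral.integrableOn_Ioo_rpow_iff one_pos).2 (by norm_num)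
  refine lt_of_le_of_lt (lintegral_mono fun u => ?_) h.2
  unfold wt
  exact Real.ofReal_le_enorm _

lemma lemB (K : ℝ → ℂ) (hK : Measurable K) (hKi : ∫⁻ u in Set.Ioo (0:ℝ) 1, ‖K u‖ₑ * wt u < ⊤)
    (ε : ENNReal) (hε : ε ≠ 0) :
    ∃ p : Polynomial ℂ, ∫⁻ u in Set.Ioo (0:ℝ) 1, ‖K u - p.eval (u : ℂ)‖ₑ * wt u ≤ ε := by
  set μ := (volume.restrict (Set.Ioo (0:ℝ) 1)).withDensity wt with hμ
  have hfin : IsFiniteMeasure μ := isFiniteMeasure_withDensity lintegral_wt_lt_top.ne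
  have conv : ∀ g : ℝ → ENNReal, Measurable g →
      ∫⁻ u, g u ∂μ = ∫⁻ u in Set.Ioo (0:ℝ) 1, g u * wt u := by
    intro g hg
    rw [hμ, lintegral_withDensity_eq_lintegral_mul _ measurable_wt hg]
    simp [mul_comm]
  have hint : Integrable K μ := by
    refine ⟨hK.aestronglyMeasurable, ?_⟩
    rw [HasFiniteIntegral, conv _ (by fun_prop)]
    exact hKi
  have hε2 : ε / 2 ≠ 0 := by simpa using hε
  obtain ⟨g, -, hg, hgc, hgi⟩ := hint.exists_hasCompactSupport_lintegral_sub_le hε2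
  obtain ⟨δ, hδ, hδε⟩ : ∃ δ : ℝ, 0 < δ ∧ ENNReal.ofReal (2 * δ) * ∫⁻ u in Set.Ioo (0:ℝ) 1, wt u ≤ ε / 2 := by
    have ht := lintegral_wt_lt_top
    have : Tendsto (fun δ : ℝ => ENNReal.ofReal (2 * δ) * ∫⁻ u in Set.Ioo (0:ℝ) 1, wt u) (nhdsWithin 0 (Set.Ioi 0)) (nhds (ENNReal.ofReal (2 * 0) * ∫⁻ u in Set.Ioo (0:ℝ) 1, wt u)) := by
      refine ENNReal.Tendsto.mul_const ?_ (Or.inr ht.ne)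
      exact (ENNReal.continuous_ofReal.comp (continuous_const.mul continuous_id)).continuousAt.tendsto.mono_left nhdsWithin_le_nhds
    have h2 := this.eventually_le_const (u := ε / 2) (by simpa using hε)
    obtain ⟨δ, h3, h4⟩ := (h2.and self_mem_nhdsWithin).exists
    exact ⟨δ, h4, h3⟩
  obtain ⟨p, hp⟩ := exists_polynomial_near_of_continuousOn 0 1 (fun x => (g x).re)
    (by fun_prop) δ hδ
  obtain ⟨q, hq⟩ := exists_polynomial_near_of_continuousOn 0 1 (fun x => (g x).im)
    (by fun_prop) δ hδ
  refine ⟨p.map Complex.ofRealHom + Polynomial.C Complex.I * q.map Complex.ofRealHom, ?_⟩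
  set P := p.map Complex.ofRealHom + Polynomial.C Complex.I * q.map Complex.ofRealHom with hP
  have hPe : ∀ u : ℝ, P.eval (u:ℂ) = ((p.eval u : ℝ) : ℂ) + Complex.I * ((q.eval u : ℝ) : ℂ) := by
    intro u
    have h1 : ∀ r : Polynomial ℝ, (r.map Complex.ofRealHom).eval (u:ℂ) = ((r.eval u : ℝ) : ℂ) := by
      intro r
      exact Polynomial.eval_map_apply (f := Complex.ofRealHom) u
    simp [hP, h1]
  have hPm : Measurable fun u : ℝ => P.eval (u:ℂ) :=
    (P.continuous.comp Complex.continuous_ofReal).measurable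
  have hgm : Measurable g := hgc.measurable
  have hb : ∀ u ∈ Set.Ioo (0:ℝ) 1, ‖K u - P.eval (u:ℂ)‖ₑ * wt u ≤
      ‖K u - g u‖ₑ * wt u + ENNReal.ofReal (2 * δ) * wt u := by
    intro u hu
    rw [← add_mul]
    gcongr
    have h1 : ‖g u - P.eval (u:ℂ)‖ ≤ 2 * δ := by
      have hu' : u ∈ Set.Icc (0:ℝ) 1 := ⟨hu.1.le, hu.2.le⟩
      have h1 := hp u hu'
      have h2 := hq u hu'
      refine (Complex.norm_le_abs_re_add_abs_im _).trans ?_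
      rw [hPe]
      simp
      rw [abs_sub_comm] at h1 h2
      linarith
    calc ‖K u - P.eval (u:ℂ)‖ₑ = ‖(K u - g u) + (g u - P.eval (u:ℂ))‖ₑ := by simp
      _ ≤ _ := enorm_add_le _ _
      _ ≤ _ := by
        gcongr
        rw [← ofReal_norm]
        exact ENNReal.ofReal_le_ofReal h1
  calc _ ≤ ∫⁻ u in Set.Ioo (0:ℝ) 1, (‖K u - g u‖ₑ * wt u + ENNReal.ofReal (2 * δ) * wt u) :=
        setLIntegral_mono' measurableSet_Ioo hb
    _ = (∫⁻ u, ‖K u - g u‖ₑ ∂μ) + ENNReal.ofReal (2 * δ) * ∫⁻ u in Set.Ioo (0:ℝ) 1, wt u := by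
        have := measurable_wt
        rw [lintegral_add_left (by fun_prop), conv _ (by fun_prop), lintegral_const_mul _ this]
    _ ≤ ε / 2 + ε / 2 := add_le_add hg hδε
    _ = ε := ENNReal.add_halves ε

lemma exp_image : (fun s : ℝ => Real.exp (-s)) '' Set.Ioi 0 = Set.Ioo 0 1 := by
  ext u
  constructor
  · rintro ⟨s, hs, rfl⟩
    exact ⟨Real.exp_pos _, by simpa using hs⟩
  · rintro ⟨h0, h1⟩
    exact ⟨-Real.log u, by simpa using Real.log_neg h0 h1, by simp [Real.exp_log h0]⟩

lemma exp_deriv' : ∀ x ∈ Set.Ioi (0:ℝ), HasDerivWithinAt (fun s : ℝ => Real.exp (-s))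
    (-Real.exp (-x)) (Set.Ioi 0) x := by
  intro x _
  have := ((hasDerivAt_id x).neg.exp).hasDerivWithinAt (s := Set.Ioi 0)
  simpa using this

lemma exp_inj' : Set.InjOn (fun s : ℝ => Real.exp (-s)) (Set.Ioi 0) := by
  intro a _ b _ h
  simpa using h

lemma measurable_holderKernel (α : ℂ) : Measurable (holderKernel α) := by
  unfold holderKernel
  refine Measurable.ite measurableSet_Ioo ?_ measurable_const
  fun_prop

lemma holder_subst (α z : ℂ) (s : ℝ) (hs : s ∈ Set.Ioi (0:ℝ)) :
    |-Real.exp (-s)| • (holderKernel α (Real.exp (-s)) * ((Real.exp (-s) : ℝ) : ℂ) ^ (z - 1)) =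
    (Complex.Gamma α)⁻¹ * ((s : ℂ) ^ (α - 1) * Complex.exp (-(z * s))) := by
  have hm : Real.exp (-s) ∈ Set.Ioo (0:ℝ) 1 := by
    rw [← exp_image]; exact ⟨s, hs, rfl⟩
  rw [holderKernel, if_pos hm, abs_neg, abs_of_pos (Real.exp_pos _)]
  have h1 : Real.log (Real.exp (-s))⁻¹ = s := by simp [← Real.exp_neg]
  rw [h1, Complex.ofReal_exp, Complex.cpow_def_of_ne_zero (Complex.exp_ne_zero _),
    ← Complex.ofReal_exp, ← Complex.ofReal_log (Real.exp_pos _).le, Real.log_exp, Complex.real_smul]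
  have h2 : Complex.exp (-(z * s)) = ((Real.exp (-s) : ℝ) : ℂ) * Complex.exp (((-s : ℝ) : ℂ) * (z - 1)) := by
    rw [Complex.ofReal_exp, ← Complex.exp_add]
    congr 1
    push_cast; ring
  rw [h2]; ring

lemma laplace_cpow {a r : ℂ} (ha : 0 < a.re) (hr : 0 < r.re) :
    ∫ t : ℝ in Set.Ioi 0, (t : ℂ) ^ (a - 1) * Complex.exp (-(r * t)) = (1 / r) ^ a * Complex.Gamma a := by
  have hmeas : ∀ (b w : ℂ), AEStronglyMeasurable
      (fun t : ℝ => (t : ℂ) ^ b * Complex.exp (-(w * t))) (volume.restrict (Set.Ioi 0)) := by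
    intro b w
    apply Measurable.aestronglyMeasurable
    fun_prop
  have hnorm : ∀ (b w : ℂ) (t : ℝ), 0 < t →
      ‖(t : ℂ) ^ b * Complex.exp (-(w * t))‖ = t ^ b.re * Real.exp (-w.re * t) := by
    intro b w t ht
    rw [norm_mul, Complex.norm_cpow_eq_rpow_re_of_pos ht, Complex.norm_exp]
    simp
  have hint0 : ∀ (b c : ℝ), -1 < b → 0 < c →
      IntegrableOn (fun t : ℝ => t ^ b * Real.exp (-c * t)) (Set.Ioi 0) := by
    intro b c hb hc
    have := integrableOn_rpow_mul_exp_neg_mul_rpow (p := 1) (s := b) (b := c) hb (by norm_num) hc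
    simpa using this
  have hint : ∀ (b w : ℂ), -1 < b.re → 0 < w.re →
      IntegrableOn (fun t : ℝ => (t : ℂ) ^ b * Complex.exp (-(w * t))) (Set.Ioi 0) := by
    intro b w hb hw
    refine Integrable.mono' (hint0 b.re w.re hb hw) (hmeas b w) ?_
    filter_upwards [ae_restrict_mem measurableSet_Ioi] with t ht
    exact (hnorm b w t ht).le
  have hU : IsOpen {z : ℂ | 0 < z.re} := isOpen_lt continuous_const Complex.continuous_re
  have hF : DifferentiableOn ℂ (fun r : ℂ => ∫ t : ℝ in Set.Ioi 0,
      (t : ℂ) ^ (a - 1) * Complex.exp (-(r * t))) {z : ℂ | 0 < z.re} := by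
    intro r0 hr0
    have hr0 : 0 < r0.re := hr0
    have hball : ∀ w ∈ Metric.ball r0 (r0.re / 2), r0.re / 2 ≤ w.re := by
      intro w hw
      rw [Metric.mem_ball, dist_eq_norm] at hw
      have := (abs_le.1 (Complex.abs_re_le_norm (w - r0))).1
      simp at this
      linarith
    have := hasDerivAt_integral_of_dominated_loc_of_deriv_le
      (μ := volume.restrict (Set.Ioi (0:ℝ)))
      (F := fun (w : ℂ) (t : ℝ) => (t : ℂ) ^ (a - 1) * Complex.exp (-(w * t)))
      (F' := fun (w : ℂ) (t : ℝ) => (t : ℂ) ^ (a - 1) * (Complex.exp (-(w * t)) * (-t)))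
      (x₀ := r0) (s := Metric.ball r0 (r0.re / 2))
      (bound := fun t => t ^ a.re * Real.exp (-(r0.re / 2) * t))
      (Metric.ball_mem_nhds _ (by positivity))
      (Eventually.of_forall fun w => hmeas _ w)
      (hint _ _ (by simpa using ha) hr0)
      (by apply Measurable.aestronglyMeasurable; fun_prop)
      (by
        filter_upwards [ae_restrict_mem measurableSet_Ioi] with t ht w hw
        have ht : 0 < t := ht
        have h1 := hball w hw
        rw [← mul_assoc, norm_mul, hnorm _ _ _ ht, norm_neg, Complex.norm_of_nonneg ht.le]
        have h2 : t ^ (a - 1).re * t = t ^ a.re := by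
          rw [← Real.rpow_add_one ht.ne']; simp
        rw [mul_right_comm, h2]
        gcongr)
      (hint0 _ _ (by linarith) (by linarith))
      (by
        filter_upwards with t w hw
        have h1 : HasDerivAt (fun w : ℂ => -(w * (t:ℂ))) (-(t:ℂ)) w := by
          have h0 := ((hasDerivAt_id w).mul_const (t:ℂ)).neg
          rw [one_mul] at h0
          exact h0
        exact h1.cexp.const_mul _)
    exact this.2.differentiableAt.differentiableWithinAt
  have hG : DifferentiableOn ℂ (fun r : ℂ => (1 / r) ^ a * Complex.Gamma a) {z : ℂ | 0 < z.re} := by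
    intro w hw
    have hw : 0 < w.re := hw
    have hw0 : w ≠ 0 := by rintro rfl; simp at hw
    apply DifferentiableAt.differentiableWithinAt
    refine DifferentiableAt.mul_const ?_ _
    refine DifferentiableAt.cpow ?_ (differentiableAt_const _) ?_
    · exact (differentiableAt_const (1:ℂ)).div differentiableAt_id hw0
    · left
      rw [one_div, Complex.inv_re]
      exact div_pos hw (Complex.normSq_pos.2 hw0)
  have hpc : IsPreconnected {z : ℂ | 0 < z.re} := (convex_halfSpace_re_gt 0).isPreconnected
  refine (hF.analyticOnNhd hU).eqOn_of_preconnected_of_frequently_eq (hG.analyticOnNhd hU) hpc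
    (z₀ := 1) (by simp) ?_ hr
  have ht : Tendsto (fun x : ℝ => (x : ℂ)) (nhdsWithin 1 (Set.Ioi 1)) (nhdsWithin (1:ℂ) {1}ᶜ) := by
    refine tendsto_nhdsWithin_iff.2 ⟨?_, ?_⟩
    · have := (Complex.continuous_ofReal.tendsto (1:ℝ)).mono_left (nhdsWithin_le_nhds (s := Set.Ioi 1))
      simpa using this
    · filter_upwards [self_mem_nhdsWithin] with x hx
      have hx : 1 < x := hx
      simp only [Set.mem_compl_iff, Set.mem_singleton_iff]
      exact_mod_cast hx.ne'
  refine ht.frequently (Eventually.frequently ?_)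
  filter_upwards [self_mem_nhdsWithin] with x hx
  have hx : 1 < x := hx
  exact Complex.integral_cpow_mul_exp_neg_mul_Ioi ha (by linarith)

lemma holder_integral (α z : ℂ) (hα : 0 < α.re) (hz : 0 < z.re) :
    ∫ u in Set.Ioo (0:ℝ) 1, holderKernel α u * (u : ℂ) ^ (z - 1) = (1 / z) ^ α := by
  rw [← exp_image, integral_image_eq_integral_abs_deriv_smul measurableSet_Ioi exp_deriv' exp_inj']
  rw [setIntegral_congr_fun measurableSet_Ioi (fun s hs => holder_subst α z s hs)]
  rw [integral_const_mul, laplace_cpow hα hz]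
  have := Complex.Gamma_ne_zero_of_re_pos hα
  field_simp

lemma holder_integrable (α : ℂ) (hα : 0 < α.re) :
    IntegrableOn (fun u : ℝ => holderKernel α u * (u : ℂ) ^ ((1/2 : ℂ) - 1)) (Set.Ioo 0 1) := by
  rw [← exp_image, integrableOn_image_iff_integrableOn_abs_deriv_smul measurableSet_Ioi exp_deriv' exp_inj']
  rw [integrableOn_congr_fun (fun s hs => holder_subst α _ s hs) measurableSet_Ioi]
  refine Integrable.const_mul ?_ _
  have h := (Complex.GammaIntegral_convergent hα)
  have h2 := (integrableOn_Ioi_comp_mul_left_iff (fun x : ℝ => ((Real.exp (-x) : ℝ) : ℂ) * (x : ℂ) ^ (α - 1)) 0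
    (show (0:ℝ) < 1/2 by norm_num)).2 (by simpa using h)
  have h3 := h2.const_mul (((1/2 : ℝ) : ℂ) ^ (α - 1))⁻¹
  refine IntegrableOn.congr_fun h3 ?_ measurableSet_Ioi
  intro s hs
  have hs : 0 < s := hs
  have hne : (((1/2 : ℝ) : ℂ) ^ (α - 1)) ≠ 0 := by
    rw [Complex.cpow_ne_zero_iff]; left; norm_num
  simp only
  rw [Complex.ofReal_mul, Complex.mul_cpow_ofReal_nonneg (by norm_num) hs.le]
  field_simp
  rw [Complex.ofReal_exp, mul_comm]
  congr 2
  push_cast; ring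

lemma norm_cpow_wt (z : ℂ) (hz : z.re = 1/2) (u : ℝ) (hu : 0 < u) :
    ‖(u : ℂ) ^ (z - 1)‖ₑ = wt u := by
  rw [← ofReal_norm, Complex.norm_cpow_eq_rpow_re_of_pos hu, wt]
  congr 2
  simp [hz]; norm_num

lemma holder_wt (α : ℂ) (hα : 0 < α.re) :
    ∫⁻ u in Set.Ioo (0:ℝ) 1, ‖holderKernel α u‖ₑ * wt u < ⊤ := by
  have h := (holder_integrable α hα).2
  rw [HasFiniteIntegral] at h
  refine lt_of_le_of_lt (le_of_eq ?_) h
  refine setLIntegral_congr_fun measurableSet_Ioo fun u hu => ?_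
  rw [enorm_mul, norm_cpow_wt _ (by norm_num) u hu.1]

lemma mono_integral (z : ℂ) (hz : 0 < z.re) (n : ℕ) :
    ∫ u in Set.Ioo (0:ℝ) 1, (u : ℂ) ^ n * (u : ℂ) ^ (z - 1) = 1 / (n + z) := by
  have e : ∀ u ∈ Set.Ioo (0:ℝ) 1, (u : ℂ) ^ n * (u : ℂ) ^ (z - 1) = (u : ℂ) ^ ((n : ℂ) + z - 1) := by
    intro u hu
    have : (u:ℂ) ≠ 0 := by exact_mod_cast hu.1.ne'
    rw [← Complex.cpow_natCast, ← Complex.cpow_add _ _ this]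
    congr 1; ring
  rw [setIntegral_congr_fun measurableSet_Ioo e, ← integral_Ioc_eq_integral_Ioo,
    ← intervalIntegral.integral_of_le zero_le_one, integral_cpow]
  · have : (n : ℂ) + z ≠ 0 := by
      intro h
      have := congrArg Complex.re h
      simp at this
      have : (0:ℝ) ≤ n := by positivity
      linarith
    simp [Complex.zero_cpow this]
  · left
    simp
    have : (0:ℝ) ≤ n := by positivity
    linarith

lemma lemE (k : ℝ → ℂ) (hk : IntegrableOn k (Set.Ioo 0 1)) (m : ℕ) :
    ∫ u in Set.Ioo (0:ℝ) 1, (u : ℂ) ^ (m + 1) * ∫ v in Set.Ioo (0:ℝ) 1, k (v * u) =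
      ∫ t in Set.Ioo (0:ℝ) 1, (((1 - t ^ (m + 1)) / (m + 1) : ℝ) : ℂ) * k t := by
  have h1 : ∀ u ∈ Set.Ioo (0:ℝ) 1, (u : ℂ) ^ (m + 1) * ∫ v in Set.Ioo (0:ℝ) 1, k (v * u) =
      ∫ t in Set.Ioo (0:ℝ) 1, Set.indicator {p : ℝ × ℝ | p.2 < p.1}
        (fun p => (p.1 : ℂ) ^ m * k p.2) (u, t) := by
    intro u hu
    have hu0 : (u : ℂ) ≠ 0 := by exact_mod_cast hu.1.ne'
    have e1 : ∫ v in Set.Ioo (0:ℝ) 1, k (v * u) = (u : ℂ)⁻¹ * ∫ t in Set.Ioo 0 u, k t := by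
      rw [← integral_Ioc_eq_integral_Ioo, ← intervalIntegral.integral_of_le zero_le_one,
        intervalIntegral.integral_comp_mul_right _ hu.1.ne', ← integral_Ioc_eq_integral_Ioo,
        zero_mul, one_mul, intervalIntegral.integral_of_le hu.1.le, Complex.real_smul,
        Complex.ofReal_inv]
    have e2 : (fun t : ℝ => Set.indicator {p : ℝ × ℝ | p.2 < p.1}
        (fun p => (p.1 : ℂ) ^ m * k p.2) (u, t)) =
        Set.indicator (Set.Iio u) (fun t => (u : ℂ) ^ m * k t) := by
      ext t
      simp [Set.indicator]
    rw [e2, setIntegral_indicator measurableSet_Iio, e1, integral_const_mul]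
    have e3 : Set.Ioo (0:ℝ) 1 ∩ Set.Iio u = Set.Ioo 0 u := by
      ext t
      simp only [Set.mem_inter_iff, Set.mem_Ioo, Set.mem_Iio]
      have := hu.2
      constructor
      · rintro ⟨⟨a, b⟩, c⟩; exact ⟨a, c⟩
      · rintro ⟨a, c⟩; exact ⟨⟨a, by linarith⟩, c⟩
    rw [e3, pow_succ]
    field_simp
  rw [setIntegral_congr_fun measurableSet_Ioo h1]
  have hpow : IntegrableOn (fun u : ℝ => (u : ℂ) ^ m) (Set.Ioo 0 1) := by
    refine (Continuous.integrableOn_Icc (a := (0:ℝ)) (b := 1) (by fun_prop)).mono_set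
      Set.Ioo_subset_Icc_self
  have hI : Integrable (Function.uncurry fun u t : ℝ => Set.indicator {p : ℝ × ℝ | p.2 < p.1}
        (fun p => (p.1 : ℂ) ^ m * k p.2) (u, t))
      ((volume.restrict (Set.Ioo 0 1)).prod (volume.restrict (Set.Ioo 0 1))) :=
    (Integrable.mul_prod (f := fun u : ℝ => (u:ℂ) ^ m) (g := k) hpow hk).indicator
      (measurableSet_lt measurable_snd measurable_fst)
  rw [integral_integral_swap hI]
  refine setIntegral_congr_fun measurableSet_Ioo fun t ht => ?_
  have e2 : (fun u : ℝ => Set.indicator {p : ℝ × ℝ | p.2 < p.1}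
        (fun p => (p.1 : ℂ) ^ m * k p.2) (u, t)) =
        Set.indicator (Set.Ioi t) (fun u => (u : ℂ) ^ m * k t) := by
    ext u
    simp [Set.indicator]
  have e3 : Set.Ioo (0:ℝ) 1 ∩ Set.Ioi t = Set.Ioo t 1 := by
    ext u
    simp only [Set.mem_inter_iff, Set.mem_Ioo, Set.mem_Ioi]
    have := ht.1
    constructor
    · rintro ⟨⟨a, b⟩, c⟩; exact ⟨c, b⟩
    · rintro ⟨a, c⟩; exact ⟨⟨by linarith, c⟩, a⟩
  rw [e2, setIntegral_indicator measurableSet_Ioi, e3, integral_mul_const]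
  congr 1
  have e4 : ∀ u : ℝ, (u : ℂ) ^ m = ((u ^ m : ℝ) : ℂ) := by intro u; push_cast; rfl
  simp_rw [e4]
  rw [integral_complex_ofReal, ← integral_Ioc_eq_integral_Ioo,
    ← intervalIntegral.integral_of_le ht.2.le, integral_pow]
  simp

lemma qmp (x : ℝ) (hx : x ≠ 0) :
    Measure.QuasiMeasurePreserving (fun u : ℝ => u * x) volume volume := by
  refine ⟨by fun_prop, ?_⟩
  rw [Real.map_volume_mul_right hx]
  exact Measure.smul_absolutelyContinuous

lemma intScale (f : L2) (x : ℝ) (hx : x ≠ 0) (q : ℝ → ℂ) (hq : Continuous q) :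
    IntegrableOn (fun u : ℝ => q u * f (u * x)) (Set.Ioo 0 1) := by
  have h0 : IntegrableOn (f : ℝ → ℂ) (Set.Icc (-|x|) |x|) :=
    ((Lp.memLp f).locallyIntegrable (by norm_num)).integrableOn_isCompact isCompact_Icc
  have h1 := ((integrable_indicator_iff measurableSet_Icc).2 h0).comp_mul_right' hx
  have h2 : IntegrableOn (fun u : ℝ => f (u * x)) (Set.Icc 0 1) := by
    refine IntegrableOn.congr_fun (h1.integrableOn (s := Set.Icc 0 1)) ?_ measurableSet_Icc
    intro u hu
    refine Set.indicator_of_mem ?_ _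
    rw [Set.mem_Icc, ← abs_le, abs_mul, abs_of_nonneg hu.1]
    have := hu.2
    nlinarith [abs_nonneg x]
  exact (h2.continuousOn_mul hq.continuousOn isCompact_Icc).mono_set Set.Ioo_subset_Icc_self

lemma one_add_ne (z : ℂ) (hz : z ∈ Metric.sphere (1:ℂ) 1) (n : ℕ) : 1 + (n : ℂ) * z ≠ 0 := by
  intro h
  rw [mem_sphere_iff_norm] at hz
  have h1 := (abs_le.1 ((Complex.abs_re_le_norm (z - 1)).trans hz.le)).1
  have h2 := congrArg Complex.re h
  simp at h1 h2
  have : (0:ℝ) ≤ n := by positivity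
  nlinarith

lemma lemR (C : L2 →L[ℂ] L2) (hC : IsCesaroOp C) (hN : IsStarNormal C)
    (hσ : spectrum ℂ C = Metric.sphere (1:ℂ) 1) (n : ℕ) (f : L2) :
    ∀ᵐ x : ℝ, cfc (fun z : ℂ => z / (1 + n * z)) C f x =
      ∫ u in Set.Ioo (0:ℝ) 1, (u : ℂ) ^ n * f (u * x) := by
  rcases n with _ | m
  · have : cfc (fun z : ℂ => z / (1 + (0:ℕ) * z)) C = C := by
      simp only [Nat.cast_zero, zero_mul, add_zero, div_one]
      exact cfc_id' ℂ C
    rw [this]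
    simpa using hC f
  set n := m + 1 with hn
  have hcont : ContinuousOn (fun z : ℂ => (1 + (n:ℂ) * z)⁻¹) (spectrum ℂ C) := by
    refine ContinuousOn.inv₀ (by fun_prop) ?_
    intro z hz
    rw [hσ] at hz
    exact one_add_ne z hz n
  set S := cfc (fun z : ℂ => (1 + (n:ℂ) * z)⁻¹) C with hS
  have hR : cfc (fun z : ℂ => z / (1 + n * z)) C = C * S := by
    simp only [div_eq_mul_inv]
    rw [cfc_mul (fun z : ℂ => z) _ C (by fun_prop) hcont, cfc_id' ℂ C]
  have hinv : S + (n : ℂ) • (C * S) = 1 := by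
    rw [← hR, hS, ← cfc_const_mul (n:ℂ) _ C (by simp only [div_eq_mul_inv]; exact continuousOn_id.mul hcont),
      ← cfc_add _ _ _ hcont (by simp only [div_eq_mul_inv]; exact continuousOn_const.mul (continuousOn_id.mul hcont)), ← cfc_one ℂ C]
    refine cfc_congr ?_
    intro z hz
    rw [hσ] at hz
    have := one_add_ne z hz n
    simp only [Pi.one_apply]
    field_simp
  set h : L2 := S f with hh
  have hf : h + (n : ℂ) • C h = f := by
    have := congrArg (fun T : L2 →L[ℂ] L2 => T f) hinv
    simpa using this
  have hfae : ∀ᵐ y : ℝ, f y = h y + (n : ℂ) * C h y := by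
    have h1 := Lp.coeFn_add h ((n : ℂ) • C h)
    have h2 := Lp.coeFn_smul (n : ℂ) (C h)
    rw [hf] at h1
    filter_upwards [h1, h2] with y a b
    rw [a, Pi.add_apply, b]; rfl
  rw [hR]
  have hx0 : ∀ᵐ x : ℝ, x ≠ 0 := by
    have : volume ({0} : Set ℝ) = 0 := by simp
    exact compl_mem_ae_iff.2 this
  filter_upwards [hC h, hx0] with x hx hx0
  have hy := (qmp x hx0).ae hfae
  have hy2 := (qmp x hx0).ae (hC h)
  have e : ∫ u in Set.Ioo (0:ℝ) 1, (u : ℂ) ^ n * f (u * x) =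
      ∫ u in Set.Ioo (0:ℝ) 1, ((u : ℂ) ^ n * h (u * x) + (n : ℂ) * ((u : ℂ) ^ n * C h (u * x))) := by
    refine integral_congr_ae ?_
    filter_upwards [ae_restrict_of_ae hy] with u hu
    rw [hu]; ring
  have e2 : ∫ u in Set.Ioo (0:ℝ) 1, (u : ℂ) ^ n * C h (u * x) =
      ∫ u in Set.Ioo (0:ℝ) 1, (u : ℂ) ^ (m + 1) * ∫ v in Set.Ioo (0:ℝ) 1, h ((v * u) * x) := by
    refine integral_congr_ae ?_
    filter_upwards [ae_restrict_of_ae hy2] with u hu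
    rw [hu, hn]
    simp only [mul_assoc]
  have hk := intScale h x hx0 (fun _ => 1) continuous_const
  simp only [one_mul] at hk
  have e3 := lemE (fun t => h (t * x)) hk m
  rw [ContinuousLinearMap.mul_apply, ← hh, hx, e,
    integral_add (intScale h x hx0 (fun u => (u:ℂ) ^ n) (by fun_prop))
      ((intScale (C h) x hx0 (fun u => (u:ℂ) ^ n) (by fun_prop)).const_mul _),
    integral_const_mul, e2, e3, ← integral_const_mul, ← integral_add
      (intScale h x hx0 (fun u => (u:ℂ) ^ n) (by fun_prop))
      ((intScale h x hx0 (fun t => (((1 - t ^ (m + 1)) / (m + 1) : ℝ) : ℂ)) (by fun_prop)).const_mul _)]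
  refine integral_congr_ae (Eventually.of_forall fun u => ?_)
  have : ((m:ℂ) + 1) ≠ 0 := by exact_mod_cast Nat.succ_ne_zero m
  rw [hn]
  push_cast
  field_simp
  ring

lemma integrable_symbol (L : ℝ → ℂ) (hL : Measurable L)
    (hLi : ∫⁻ u in Set.Ioo (0:ℝ) 1, ‖L u‖ₑ * wt u < ⊤) (w : ℂ) (hw : w.re = 1/2) :
    IntegrableOn (fun u : ℝ => L u * (u : ℂ) ^ (w - 1)) (Set.Ioo 0 1) := by
  refine ⟨(by apply Measurable.aestronglyMeasurable; fun_prop), ?_⟩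
  rw [HasFiniteIntegral]
  refine lt_of_le_of_lt (le_of_eq ?_) hLi
  refine setLIntegral_congr_fun measurableSet_Ioo fun u hu => ?_
  rw [enorm_mul, norm_cpow_wt _ hw u hu.1]

lemma pow_wt (n : ℕ) : ∫⁻ u in Set.Ioo (0:ℝ) 1, ‖(u : ℂ) ^ n‖ₑ * wt u < ⊤ := by
  refine lt_of_le_of_lt (setLIntegral_mono' measurableSet_Ioo fun u hu => ?_) lintegral_wt_lt_top
  refine mul_le_of_le_one_left' ?_
  rw [← ofReal_norm, norm_pow, Complex.norm_of_nonneg hu.1.le]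
  exact ENNReal.ofReal_le_one.2 (pow_le_one₀ hu.1.le hu.2.le)

/-- the symbol of a polynomial kernel -/
def polySym (p : Polynomial ℂ) : ℂ → ℂ :=
  ∑ n ∈ p.support, fun z => p.coeff n * (z / (1 + n * z))

lemma poly_eval (p : Polynomial ℂ) (u : ℂ) :
    p.eval u = ∑ n ∈ p.support, p.coeff n * u ^ n := Polynomial.eval_eq_sum

lemma polySym_integral (p : Polynomial ℂ) (w : ℂ) (hw : w.re = 1/2) :
    IntegrableOn (fun u : ℝ => p.eval (u : ℂ) * (u : ℂ) ^ (w - 1)) (Set.Ioo 0 1) ∧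
    ∫ u in Set.Ioo (0:ℝ) 1, p.eval (u : ℂ) * (u : ℂ) ^ (w - 1) = polySym p (1 / w) := by
  have hw0 : w ≠ 0 := by rintro rfl; norm_num at hw
  have hi : ∀ n ∈ p.support, IntegrableOn
      (fun u : ℝ => p.coeff n * ((u:ℂ) ^ n * (u : ℂ) ^ (w - 1))) (Set.Ioo 0 1) := fun n _ =>
    (integrable_symbol (fun u => (u:ℂ) ^ n) (by fun_prop) (pow_wt n) w hw).const_mul _
  have e : (fun u : ℝ => p.eval (u : ℂ) * (u : ℂ) ^ (w - 1)) =
      fun u : ℝ => ∑ n ∈ p.support, p.coeff n * ((u:ℂ) ^ n * (u : ℂ) ^ (w - 1)) := by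
    ext u
    rw [poly_eval, Finset.sum_mul]
    simp only [mul_assoc]
  rw [e]
  refine ⟨integrable_finsetSum _ hi, ?_⟩
  rw [integral_finsetSum _ hi, polySym, Finset.sum_apply]
  refine Finset.sum_congr rfl fun n _ => ?_
  rw [integral_const_mul, mono_integral w (by rw [hw]; norm_num)]
  congr 1
  have h1 : (n : ℂ) + w ≠ 0 := by
    intro h
    have := congrArg Complex.re h
    simp [hw] at this
    have : (0:ℝ) ≤ n := by positivity
    linarith
  have h2 : 1 + (n:ℂ) * (1 / w) = (n + w) / w := by field_simp; ring
  rw [h2]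
  field_simp

lemma sphere_inv_re (z : ℂ) (hz : z ∈ Metric.sphere (1:ℂ) 1) (h0 : z ≠ 0) : (1 / z).re = 1/2 := by
  rw [mem_sphere_iff_norm] at hz
  have h1 : Complex.normSq (z - 1) = 1 := by rw [Complex.normSq_eq_norm_sq, hz]; norm_num
  have h2 := Complex.normSq_pos.2 h0
  rw [one_div, Complex.inv_re]
  rw [Complex.normSq_apply] at h1 h2 ⊢
  simp at h1
  rw [div_eq_div_iff h2.ne' (by norm_num)]
  linarith

lemma symbol_bound (α : ℂ) (hα : 0 < α.re) (p : Polynomial ℂ) (ε : ℝ) (hε : 0 < ε)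
    (hp : ∫⁻ u in Set.Ioo (0:ℝ) 1, ‖holderKernel α u - p.eval (u : ℂ)‖ₑ * wt u ≤ ENNReal.ofReal ε)
    (z : ℂ) (hz : z ∈ Metric.sphere (1:ℂ) 1) : ‖z ^ α - polySym p z‖ ≤ ε := by
  by_cases h0 : z = 0
  · subst h0
    have : α ≠ 0 := by rintro rfl; simp at hα
    simp [polySym, Complex.zero_cpow this, hε.le]
  have hw := sphere_inv_re z hz h0
  obtain ⟨h1, h2⟩ := polySym_integral p (1 / z) hw
  have h3 := integrable_symbol _ (measurable_holderKernel α) (holder_wt α hα) (1 / z) hw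
  have h4 := holder_integral α (1 / z) hα (by rw [hw]; norm_num)
  rw [one_div_one_div] at h2 h4
  rw [← h2, ← h4, ← integral_sub h3 h1]
  have h5 : ‖∫ u in Set.Ioo (0:ℝ) 1, (holderKernel α u * (u:ℂ) ^ (1 / z - 1) -
      p.eval (u:ℂ) * (u:ℂ) ^ (1 / z - 1))‖ₑ ≤ ENNReal.ofReal ε := by
    refine (enorm_integral_le_lintegral_enorm _).trans (le_trans (le_of_eq ?_) hp)
    refine setLIntegral_congr_fun measurableSet_Ioo fun u hu => ?_
    rw [← sub_mul, enorm_mul, norm_cpow_wt _ hw u hu.1]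
  rw [← ofReal_norm] at h5
  exact (ENNReal.ofReal_le_ofReal_iff hε.le).1 h5

lemma enorm_sq_L2 (g : L2) : ‖g‖ₑ ^ 2 = ∫⁻ x, ‖g x‖ₑ ^ 2 := by
  rw [Lp.enorm_def, eLpNorm_eq_lintegral_rpow_enorm_toReal (by norm_num) (by norm_num),
    ← ENNReal.rpow_natCast, ← ENNReal.rpow_mul]
  norm_num

lemma cfc_poly (C : L2 →L[ℂ] L2) (hC : IsCesaroOp C) (hN : IsStarNormal C)
    (hσ : spectrum ℂ C = Metric.sphere (1:ℂ) 1) (p : Polynomial ℂ) :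
    ContinuousOn (polySym p) (spectrum ℂ C) ∧ ∀ f : L2, ∀ᵐ x : ℝ, cfc (polySym p) C f x =
      ∫ u in Set.Ioo (0:ℝ) 1, p.eval (u : ℂ) * f (u * x) := by
  have hc0 : ∀ n : ℕ, ContinuousOn (fun z : ℂ => z / (1 + n * z)) (spectrum ℂ C) := by
    intro n
    refine ContinuousOn.div (by fun_prop) (by fun_prop) ?_
    intro z hz
    rw [hσ] at hz
    exact one_add_ne z hz n
  have hc : ∀ n ∈ p.support, ContinuousOn (fun z : ℂ => p.coeff n * (z / (1 + n * z))) (spectrum ℂ C) :=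
    fun n _ => continuousOn_const.mul (hc0 n)
  constructor
  · have := continuousOn_finset_sum p.support hc
    refine this.congr fun z _ => ?_
    simp [polySym]
  intro f
  have e : cfc (polySym p) C = ∑ n ∈ p.support, p.coeff n • cfc (fun z : ℂ => z / (1 + n * z)) C := by
    rw [polySym, cfc_sum _ C p.support hc]
    exact Finset.sum_congr rfl fun n _ => cfc_const_mul _ _ _ (hc0 n)
  rw [e]
  have hsum : ∀ s : Finset ℕ, ∀ᵐ x : ℝ,
      (∑ n ∈ s, p.coeff n • cfc (fun z : ℂ => z / (1 + n * z)) C) f x =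
        ∑ n ∈ s, p.coeff n * ∫ u in Set.Ioo (0:ℝ) 1, (u : ℂ) ^ n * f (u * x) := by
    intro s
    induction s using Finset.induction_on with
    | empty =>
      simp only [Finset.sum_empty, ContinuousLinearMap.zero_apply]
      exact Lp.coeFn_zero _ _ _
    | insert n s hn ih =>
      simp only [Finset.sum_insert hn, ContinuousLinearMap.add_apply]
      have h1 := Lp.coeFn_add ((p.coeff n • cfc (fun z : ℂ => z / (1 + n * z)) C) f)
        ((∑ n ∈ s, p.coeff n • cfc (fun z : ℂ => z / (1 + n * z)) C) f)
      have h2 := Lp.coeFn_smul (p.coeff n) (cfc (fun z : ℂ => z / (1 + n * z)) C f)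
      filter_upwards [ih, h1, h2, lemR C hC hN hσ n f] with x a b c d
      rw [b, Pi.add_apply, a, ContinuousLinearMap.smul_apply, c, Pi.smul_apply, d, smul_eq_mul]
  have hx0 : ∀ᵐ x : ℝ, x ≠ 0 := by
    have : volume ({0} : Set ℝ) = 0 := by simp
    exact compl_mem_ae_iff.2 this
  filter_upwards [hsum p.support, hx0] with x hx hx0
  rw [hx]
  simp only [poly_eval, Finset.sum_mul, mul_assoc]
  rw [integral_finsetSum]
  · exact Finset.sum_congr rfl fun n _ => (integral_const_mul _ _).symm
  · intro n _
    exact (intScale f x hx0 (fun u => (u:ℂ) ^ n) (by fun_prop)).const_mul _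

lemma holder_ae_int (α : ℂ) (hα : 0 < α.re) (f : L2) :
    ∀ᵐ x : ℝ, IntegrableOn (fun u : ℝ => holderKernel α u * f (u * x)) (Set.Ioo 0 1) := by
  have hK := measurable_holderKernel α
  have hf : Measurable f := (Lp.stronglyMeasurable f).measurable
  have h := lemA _ f hK hf
  rw [← enorm_sq_L2] at h
  have h2 := h.trans_lt (ENNReal.mul_lt_top (ENNReal.pow_lt_top (holder_wt α hα))
    (ENNReal.pow_lt_top enorm_lt_top))
  have hm : Measurable (fun x : ℝ => ∫⁻ u in Set.Ioo (0:ℝ) 1, ‖holderKernel α u‖ₑ * ‖f (u * x)‖ₑ) := by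
    have hm2 : Measurable (Function.uncurry fun x u : ℝ => ‖holderKernel α u‖ₑ * ‖f (u * x)‖ₑ) := by
      unfold Function.uncurry
      fun_prop
    exact hm2.lintegral_prod_right
  filter_upwards [ae_lt_top (hm.pow_const 2) h2.ne] with x hx
  refine ⟨(by apply Measurable.aestronglyMeasurable; fun_prop), ?_⟩
  rw [HasFiniteIntegral]
  simp only [enorm_mul]
  by_contra hcon
  rw [not_lt, top_le_iff] at hcon
  simp [hcon] at hx

lemma op_bound (C : L2 →L[ℂ] L2) (hC : IsCesaroOp C) (hN : IsStarNormal C)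
    (hσ : spectrum ℂ C = Metric.sphere (1:ℂ) 1)
    (α : ℂ) (hα : 0 < α.re)
    (H : L2 →L[ℂ] L2) (hH : IsHausdorffOp (holderKernel α) H) (p : Polynomial ℂ) (ε : ℝ) (hε : 0 < ε)
    (hp : ∫⁻ u in Set.Ioo (0:ℝ) 1, ‖holderKernel α u - p.eval (u : ℂ)‖ₑ * wt u ≤ ENNReal.ofReal ε) :
    ‖H - cfc (polySym p) C‖ ≤ ε := by
  refine ContinuousLinearMap.opNorm_le_bound _ hε.le fun f => ?_
  have hpm : Measurable fun u : ℝ => p.eval (u:ℂ) :=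
    (p.continuous.comp Complex.continuous_ofReal).measurable
  have hx0 : ∀ᵐ x : ℝ, x ≠ 0 := by
    have : volume ({0} : Set ℝ) = 0 := by simp
    exact compl_mem_ae_iff.2 this
  have key : ∀ᵐ x : ℝ, ‖(H - cfc (polySym p) C) f x‖ₑ ^ 2 ≤
      (∫⁻ u in Set.Ioo (0:ℝ) 1, ‖holderKernel α u - p.eval (u : ℂ)‖ₑ * ‖f (u * x)‖ₑ) ^ 2 := by
    filter_upwards [hH f, (cfc_poly C hC hN hσ p).2 f, hx0, holder_ae_int α hα f,
      Lp.coeFn_sub (H f) (cfc (polySym p) C f)] with x h1 h2 h3 h4 h5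
    rw [ContinuousLinearMap.sub_apply, h5, Pi.sub_apply, h1, h2]
    have h6 : ∫ u : ℝ, holderKernel α u * f (u * x) =
        ∫ u in Set.Ioo (0:ℝ) 1, holderKernel α u * f (u * x) := by
      symm
      apply setIntegral_eq_integral_of_forall_compl_eq_zero
      intro u hu
      rw [holderKernel, if_neg hu, zero_mul]
    rw [h6, ← integral_sub h4 (intScale f x h3 (fun u => p.eval (u:ℂ)) (p.continuous.comp Complex.continuous_ofReal))]
    gcongr
    refine (enorm_integral_le_lintegral_enorm _).trans (le_of_eq ?_)
    refine lintegral_congr fun u => ?_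
    rw [← sub_mul, enorm_mul]
  have h1 := (lintegral_mono_ae key).trans (lemA (fun u => holderKernel α u - p.eval (u:ℂ)) f
    ((measurable_holderKernel α).sub hpm) (Lp.stronglyMeasurable f).measurable)
  rw [← enorm_sq_L2, ← enorm_sq_L2, ← mul_pow] at h1
  have h2 : ‖(H - cfc (polySym p) C) f‖ₑ ≤ ENNReal.ofReal ε * ‖f‖ₑ := by
    refine le_trans ?_ (mul_le_mul_left hp _)
    exact (ENNReal.pow_le_pow_left_iff (two_ne_zero)).1 h1
  rw [← ofReal_norm, ← ofReal_norm, ← ENNReal.ofReal_mul hε.le] at h2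
  exact (ENNReal.ofReal_le_ofReal_iff (by positivity)).1 h2

lemma cont_cpow (α : ℂ) (hα : 0 < α.re) :
    ContinuousOn (fun z : ℂ => z ^ α) (Metric.sphere (1:ℂ) 1) := by
  intro z hz
  apply ContinuousAt.continuousWithinAt
  by_cases h0 : z = 0
  · subst h0
    have := Complex.continuousAt_cpow_zero_of_re_pos hα
    exact ContinuousAt.comp (f := fun z : ℂ => (z, α)) (g := fun x : ℂ × ℂ => x.1 ^ x.2) this (by fun_prop)
  · refine continuousAt_cpow_const ?_
    left
    have h := sphere_inv_re z hz h0
    rw [one_div, Complex.inv_re] at h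
    by_contra hcon
    have := div_nonpos_of_nonpos_of_nonneg (not_lt.1 hcon) (Complex.normSq_nonneg z)
    linarith

/-- For `Re α > 0`, the fractional power `C^α` of the (normal)
Cesàro operator `C` on `L²(ℝ)`, taken via the functional calculus for normal
operators applied to the branch `z ↦ z^α` of the power function on the closed right
half-plane with `1^α = 1` and `0^α = 0` (which is the principal complex power
`Complex.cpow`), equals the Hölder operator `H_α`. -/
theorem stmt5
    (C : L2 →L[ℂ] L2) (hC : IsCesaroOp C) (hN : IsStarNormal C)
    (hσ : spectrum ℂ C = Metric.sphere (1:ℂ) 1)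
    (α : ℂ) (hα : 0 < α.re)
    (H : L2 →L[ℂ] L2) (hH : IsHausdorffOp (holderKernel α) H) :
    cfc (fun z : ℂ => z ^ α) C = H := by
  have hnorm : ∀ ε : ℝ, 0 < ε → ‖cfc (fun z : ℂ => z ^ α) C - H‖ ≤ ε + ε := by
    intro ε hε
    obtain ⟨p, hp⟩ := lemB _ (measurable_holderKernel α) (holder_wt α hα) (ENNReal.ofReal ε)
      (by simpa using hε)
    have h1 := op_bound C hC hN hσ α hα H hH p ε hε hp
    have h2 : ‖cfc (fun z : ℂ => z ^ α) C - cfc (polySym p) C‖ ≤ ε := by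
      rw [← cfc_sub _ _ C (by rw [hσ]; exact cont_cpow α hα) (cfc_poly C hC hN hσ p).1]
      refine norm_cfc_le hε.le fun z hz => ?_
      rw [hσ] at hz
      exact symbol_bound α hα p ε hε hp z hz
    calc ‖cfc (fun z : ℂ => z ^ α) C - H‖
        = ‖(cfc (fun z : ℂ => z ^ α) C - cfc (polySym p) C) - (H - cfc (polySym p) C)‖ := by
          congr 1; abel
      _ ≤ _ := norm_sub_le _ _
      _ ≤ ε + ε := add_le_add h2 h1
  rw [← sub_eq_zero, ← norm_le_zero_iff]
  refine le_of_forall_pos_le_add fun δ hδ => ?_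
  have := hnorm (δ / 2) (by positivity)
  linarith
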